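/- arXiv:2008.08779 — 2 statements merged into one kernel-verified Lean document; each statement's English description precedes it below -/
import Mathlib

section
/- For an arbitrary vertex z of a light tournament T, the set V₃(z) is 2-in-dominated by V₂(z). -/
variable {V : Type*}

/-- A directed triangle: arcs `a → b`, `b → c`, `c → a`. -/
def Triangle (arc : V → V → Prop) (a b c : V) : Prop :=
  arc a b ∧ arc b c ∧ arc c a

/-- A tournament: an irreflexive relation with exactly one arc between any two
distinct vertices. -/
def IsTournament (arc : V → V → Prop) : Prop :=
  (∀ v, ¬ arc v v) ∧ ∀ a b : V, a ≠ b → (arc a b ↔ ¬ arc b a)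

/-- A feedback vertex set: removing `X` leaves no directed triangle. -/
def IsFVS (arc : V → V → Prop) (X : Set V) : Prop :=
  ∀ a b c : V, a ∉ X → b ∉ X → c ∉ X → ¬ Triangle arc a b c

/-- The pair `{a,b}` is a diagonal: there are `u, v` such that both `{u,v,a}` and
`{u,v,b}` are triangles. -/
def IsDiagonal (arc : V → V → Prop) (a b : V) : Prop :=
  ∃ u v : V, Triangle arc u v a ∧ Triangle arc u v b

/-- A heavy triangle: a triangle at least two of whose vertex pairs are diagonals. -/
def HeavyTriangle (arc : V → V → Prop) (a b c : V) : Prop :=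
  Triangle arc a b c ∧
  ((IsDiagonal arc a b ∧ IsDiagonal arc b c) ∨
   (IsDiagonal arc a b ∧ IsDiagonal arc a c) ∨
   (IsDiagonal arc b c ∧ IsDiagonal arc a c))

/-- A tournament is heavy if it contains a heavy triangle. -/
def IsHeavy (arc : V → V → Prop) : Prop := ∃ a b c : V, HeavyTriangle arc a b c

/-- A tournament is light if it is not heavy. -/
def IsLight (arc : V → V → Prop) : Prop := ¬ IsHeavy arc

/-- In-neighborhood of a set `S`: vertices outside `S` with an arc into `S`. -/
def inNbhd (arc : V → V → Prop) (S : Set V) : Set V :=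
  {v | v ∉ S ∧ ∃ u ∈ S, arc v u}

/-- `ball arc z i = V₁(z) ∪ ⋯ ∪ V_i(z)`: vertices with a directed path to `z`
of length at most `i - 1`. -/
def ball (arc : V → V → Prop) (z : V) : ℕ → Set V
  | 0 => ∅
  | 1 => {z}
  | (n + 2) => ball arc z (n + 1) ∪ inNbhd arc (ball arc z (n + 1))

/-- `layerV arc z i = V_i(z)`: the set of vertices whose shortest directed path
to `z` has length exactly `i - 1` (so `V₁(z) = {z}` and
`V_{i+1}(z) = N(V₁(z) ∪ ⋯ ∪ V_i(z))`). -/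
def layerV (arc : V → V → Prop) (z : V) (i : ℕ) : Set V :=
  ball arc z i \ ball arc z (i - 1)

/-- `Z` 2-in-dominates `S`: some `Z' ⊆ Z` with `|Z'| ≤ 2` in-dominates `S`. -/
def TwoInDominates (arc : V → V → Prop) (Z S : Set V) : Prop :=
  ∃ Z' ⊆ Z, Z'.ncard ≤ 2 ∧ ∀ s ∈ S, ∃ z ∈ Z', arc s z

theorem IsTournament.asymm {arc : V → V → Prop} (hT : IsTournament arc) {a b : V}
    (h : arc a b) : ¬ arc b a := by
  by_cases hab : a = b
  · subst hab
    exact hT.1 a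
  · exact (hT.2 a b hab).1 h

theorem IsTournament.arc_of_not_arc {arc : V → V → Prop} (hT : IsTournament arc) {a b : V}
    (hab : a ≠ b) (h : ¬ arc a b) : arc b a :=
  (hT.2 b a hab.symm).2 h

theorem mem_layerV_two {arc : V → V → Prop} (hT : IsTournament arc) {z v : V} :
    v ∈ layerV arc z 2 ↔ arc v z := by
  have h : arc v z → v ≠ z := by
    rintro h rfl
    exact hT.1 _ h
  simp only [layerV, ball, inNbhd, Nat.reduceSub, Set.mem_sdiff, Set.mem_union,
    Set.mem_singleton_iff, Set.mem_ofPred_eq, exists_eq_left]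
  tauto

theorem mem_layerV_three {arc : V → V → Prop} (hT : IsTournament arc) {z s : V}
    (hs : s ∈ layerV arc z 3) : arc z s ∧ ∃ v, arc v z ∧ arc s v := by
  simp only [layerV, ball, inNbhd, Nat.reduceSub, Set.mem_sdiff, Set.mem_union,
    Set.mem_singleton_iff, Set.mem_ofPred_eq, exists_eq_left] at hs
  have hsz : ¬ arc s z := by tauto
  have hne : s ≠ z := by tauto
  refine ⟨hT.arc_of_not_arc hne hsz, ?_⟩
  obtain ⟨u, hu, hsu⟩ : ∃ u, (u = z ∨ u ≠ z ∧ arc u z) ∧ arc s u :=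
    (hs.1.resolve_left hs.2).2
  rcases hu with rfl | hu
  · exact absurd hsu hsz
  · exact ⟨u, hu.2, hsu⟩

/-- Let `s → v → z → s`, `s₁ → v₁ → z → s₁` and `s₂ → v₂ → z → s₂` be triangles of a light
tournament with `v → s₁` and `v₂ → s`. Then `v₁ → v` and `s → s₂` cannot both hold: they make
`{v, z}` and `{s, z}` diagonals. -/
theorem IsLight.false_of_private {arc : V → V → Prop} (hlight : IsLight arc)
    {z v s v₁ s₁ v₂ s₂ : V} (hvz : arc v z) (hzs : arc z s) (hsv : arc s v)
    (hv₁z : arc v₁ z) (hzs₁ : arc z s₁) (hs₁v₁ : arc s₁ v₁)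
    (hv₂z : arc v₂ z) (hzs₂ : arc z s₂) (hs₂v₂ : arc s₂ v₂)
    (hvs₁ : arc v s₁) (hv₂s : arc v₂ s) (hv₁v : arc v₁ v) (hss₂ : arc s s₂) : False :=
  hlight ⟨s, v, z, ⟨hsv, hvz, hzs⟩, Or.inr <| Or.inr
    ⟨⟨s₁, v₁, ⟨hs₁v₁, hv₁v, hvs₁⟩, ⟨hs₁v₁, hv₁z, hzs₁⟩⟩,
      ⟨s₂, v₂, ⟨hs₂v₂, hv₂s, hss₂⟩, ⟨hs₂v₂, hv₂z, hzs₂⟩⟩⟩⟩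

/-- For an arbitrary vertex `z` of a light tournament, `V₃(z)` is 2-in-dominated
by `V₂(z)`. -/
theorem stmt7 [Fintype V] (arc : V → V → Prop) (hT : IsTournament arc)
    (hlight : IsLight arc) (z : V) :
    TwoInDominates arc (layerV arc z 2) (layerV arc z 3) := by
  obtain ⟨Z, -, hZ⟩ := exists_minimal_le_of_wellFoundedLT
    (fun Z : Set V ↦ Z ⊆ layerV arc z 2 ∧ ∀ s ∈ layerV arc z 3, ∃ v ∈ Z, arc s v)
    (layerV arc z 2) ⟨subset_rfl, fun s hs ↦ by
      obtain ⟨-, v, hv, hsv⟩ := mem_layerV_three hT hs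
      exact ⟨v, (mem_layerV_two hT).2 hv, hsv⟩⟩
  refine ⟨Z, hZ.prop.1, ?_, hZ.prop.2⟩
  by_contra! hcard
  have hpriv : ∀ v ∈ Z, ∃ s, arc z s ∧ arc s v ∧ ∀ w ∈ Z, w ≠ v → arc w s := by
    intro v hv
    by_contra! hno
    have hle : Z ≤ Z \ {v} := hZ.le_of_le ⟨Set.sdiff_subset.trans hZ.prop.1, fun s hs ↦ by
      by_contra! hdom
      have hzs := (mem_layerV_three hT hs).1
      have hsv : arc s v := by
        obtain ⟨w, hw, hsw⟩ := hZ.prop.2 s hs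
        by_cases hwv : w = v
        · exact hwv ▸ hsw
        · exact absurd hsw (hdom w ⟨hw, hwv⟩)
      obtain ⟨w, hw, hwv, hws⟩ := hno s hzs hsv
      refine hws (hT.arc_of_not_arc ?_ (hdom w ⟨hw, hwv⟩))
      rintro rfl
      exact hT.asymm hzs ((mem_layerV_two hT).1 (hZ.prop.1 hw))⟩ Set.sdiff_subset
    exact (hle hv).2 rfl
  choose! s hzs hsv hpriv using hpriv
  have hvz : ∀ v ∈ Z, arc v z := fun v hv ↦ (mem_layerV_two hT).1 (hZ.prop.1 hv)
  have key : ∀ a ∈ Z, ∀ b ∈ Z, ∀ c ∈ Z, a ≠ b → c ≠ b → arc a b → ¬ arc (s b) (s c) :=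
    fun a ha b hb c hc hab hcb h₁ h₂ ↦
      hlight.false_of_private (hvz b hb) (hzs b hb) (hsv b hb) (hvz a ha) (hzs a ha) (hsv a ha)
        (hvz c hc) (hzs c hc) (hsv c hc) (hpriv a ha b hb hab.symm) (hpriv b hb c hc hcb) h₁ h₂
  have htot : ∀ a b, a ≠ b → arc a b ∨ arc b a := fun a b hab ↦
    or_iff_not_imp_left.2 (hT.arc_of_not_arc hab)
  have hs_tot : ∀ a ∈ Z, ∀ b ∈ Z, a ≠ b → arc (s a) (s b) ∨ arc (s b) (s a) := by
    refine fun a ha b hb hab ↦ htot _ _ fun h ↦ ?_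
    exact hT.asymm (hpriv b hb a ha hab) (h ▸ hsv a ha)
  obtain ⟨a, ha, b, hb, c, hc, hab, hac, hbc⟩ := (Set.two_lt_ncard (Set.toFinite Z)).1 hcard
  grind
end

section
/- Let z be a vertex of minimum in-degree in a light tournament T. Then the subtournament induced by V₂(z) (that is, by the in-neighborhood N(z)) is 𝒯₅-free. -/
variable {V : Type*}

section Tournament

variable {arc : V → V → Prop} {a b c u v z : V}

namespace IsTournament

theorem not_arc (hT : IsTournament arc) (h : arc a b) : ¬ arc b a := by
  have hne : a ≠ b := by
    rintro rfl
    exact hT.1 a h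
  exact (hT.2 a b hne).1 h

theorem arc_of_not_arc_s8 (hT : IsTournament arc) (hne : a ≠ b) (h : ¬ arc a b) : arc b a :=
  (hT.2 b a hne.symm).2 h

theorem mem_inNbhd_singleton (hT : IsTournament arc) : v ∈ inNbhd arc {z} ↔ arc v z := by
  constructor
  · rintro ⟨-, u, rfl, h⟩
    exact h
  · intro h
    refine ⟨?_, z, rfl, h⟩
    rintro rfl
    exact hT.1 _ h

/-- Every in-neighbor of a vertex `z` of minimum in-degree lies on a triangle through `z`. -/
theorem exists_arc_arc_of_min_inDegree [Finite V] (hT : IsTournament arc)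
    (hmin : ∀ v : V, (inNbhd arc {z}).ncard ≤ (inNbhd arc {v}).ncard) (hv : arc v z) :
    ∃ u, arc z u ∧ arc u v := by
  by_contra! hno
  have hsub : inNbhd arc {v} ⊂ inNbhd arc {z} := by
    rw [Set.ssubset_iff_of_subset]
    · exact ⟨v, hT.mem_inNbhd_singleton.2 hv, fun h => hT.1 v (hT.mem_inNbhd_singleton.1 h)⟩
    · intro u hu
      rw [hT.mem_inNbhd_singleton] at hu ⊢
      refine hT.arc_of_not_arc_s8 ?_ fun h => hno u h hu
      rintro rfl
      exact hT.not_arc hv hu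
  exact (Set.ncard_lt_ncard hsub (Set.toFinite _)).not_ge (hmin v)

end IsTournament

theorem Triangle.rotate (h : Triangle arc a b c) : Triangle arc b c a :=
  ⟨h.2.1, h.2.2, h.1⟩

/-- Two pairs of a triangle of a light tournament are not both diagonals. -/
theorem IsLight.not_isDiagonal (hlight : IsLight arc) (h : Triangle arc a b c)
    (hab : IsDiagonal arc a b) : ¬ IsDiagonal arc b c :=
  fun hbc => hlight ⟨a, b, c, h, Or.inl ⟨hab, hbc⟩⟩

/-- In a light tournament, no triangle `a → b → c → a` in `N(z)` has both `a, b` and `b, c`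
without common in-neighbor among the out-neighbors of `z`, if each of `a`, `b`, `c` has an
in-neighbor there. -/
theorem IsLight.exists_common_inNeighbor (hT : IsTournament arc) (hlight : IsLight arc)
    (h : Triangle arc a b c) (ha : arc a z) (hb : arc b z) (hc : arc c z)
    (hz : ∀ x, arc x z → ∃ u, arc z u ∧ arc u x) :
    (∃ u, arc z u ∧ arc u a ∧ arc u b) ∨ ∃ u, arc z u ∧ arc u b ∧ arc u c := by
  by_contra! hno
  obtain ⟨hab, hbc⟩ := hno
  have ne_of_arc {x y : V} (hx : arc x z) (hy : arc z y) : y ≠ x := by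
    rintro rfl
    exact hT.not_arc hx hy
  obtain ⟨u, hzu, hua⟩ := hz a ha
  obtain ⟨w, hzw, hwb⟩ := hz b hb
  obtain ⟨v, hzv, hvc⟩ := hz c hc
  have hbu : arc b u := hT.arc_of_not_arc_s8 (ne_of_arc hb hzu) (hab u hzu hua)
  have hcw : arc c w := hT.arc_of_not_arc_s8 (ne_of_arc hc hzw) (hbc w hzw hwb)
  have hbv : arc b v := hT.arc_of_not_arc_s8 (ne_of_arc hb hzv) fun h => hbc v hzv h hvc
  have hzb : IsDiagonal arc b z := ⟨u, a, ⟨hua, h.1, hbu⟩, ⟨hua, ha, hzu⟩⟩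
  have hne : v ≠ w := by
    rintro rfl
    exact hT.not_arc hwb hbv
  by_cases hvw : arc v w
  · have hcz : IsDiagonal arc c z := ⟨w, b, ⟨hwb, h.2.1, hcw⟩, ⟨hwb, hb, hzw⟩⟩
    have hvc' : IsDiagonal arc v c := ⟨w, b, ⟨hwb, hbv, hvw⟩, ⟨hwb, h.2.1, hcw⟩⟩
    exact hlight.not_isDiagonal ⟨hvc, hc, hzv⟩ hvc' hcz
  · have hwv : arc w v := hT.arc_of_not_arc_s8 hne hvw
    have hzw' : IsDiagonal arc z w := ⟨v, c, ⟨hvc, hc, hzv⟩, ⟨hvc, hcw, hwv⟩⟩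
    exact hlight.not_isDiagonal ⟨hb, hzw, hwb⟩ hzb hzw'

/-- In a light tournament, if every in-neighbor of `z` lies on a triangle through `z`, then
`N(z)` induces an acyclic tournament. -/
theorem IsLight.not_triangle_of_arc (hT : IsTournament arc) (hlight : IsLight arc)
    (hz : ∀ x, arc x z → ∃ u, arc z u ∧ arc u x)
    (ha : arc a z) (hb : arc b z) (hc : arc c z) : ¬ Triangle arc a b c := by
  intro h
  have diag {x y : V} (hx : arc x z) (hy : arc y z)
      (hxy : ∃ u, arc z u ∧ arc u x ∧ arc u y) : IsDiagonal arc x y := by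
    obtain ⟨u, hzu, hux, huy⟩ := hxy
    exact ⟨z, u, ⟨hzu, hux, hx⟩, ⟨hzu, huy, hy⟩⟩
  have h₁ := (hlight.exists_common_inNeighbor hT h ha hb hc hz).imp (diag ha hb) (diag hb hc)
  have h₂ := (hlight.exists_common_inNeighbor hT h.rotate hb hc ha hz).imp
    (diag hb hc) (diag hc ha)
  have h₃ := (hlight.exists_common_inNeighbor hT h.rotate.rotate hc ha hb hz).imp
    (diag hc ha) (diag ha hb)
  have n₁ := hlight.not_isDiagonal h
  have n₂ := hlight.not_isDiagonal h.rotate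
  have n₃ := hlight.not_isDiagonal h.rotate.rotate
  tauto

end Tournament

/-- If `z` is a vertex of minimum in-degree in a light tournament, then the
subtournament induced by `V₂(z) = N(z)` is `𝒯₅`-free: every 5 vertices of `N(z)`
induce a subtournament with a feedback vertex set of size at most 1. -/
theorem stmt8 [Fintype V] (arc : V → V → Prop) (hT : IsTournament arc)
    (hlight : IsLight arc) (z : V)
    (hmin : ∀ v : V, (inNbhd arc {z}).ncard ≤ (inNbhd arc {v}).ncard) :
    ∀ S : Set V, S ⊆ inNbhd arc {z} → S.ncard = 5 →
      ∃ F ⊆ S, F.ncard ≤ 1 ∧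
        ∀ a ∈ S \ F, ∀ b ∈ S \ F, ∀ c ∈ S \ F, ¬ Triangle arc a b c := by
  intro S hS _
  have arc_of_mem {x : V} (hx : x ∈ S \ ∅) : arc x z := hT.mem_inNbhd_singleton.1 (hS hx.1)
  refine ⟨∅, Set.empty_subset S, by simp, fun a ha b hb c hc => ?_⟩
  exact hlight.not_triangle_of_arc hT (fun _ => hT.exists_arc_arc_of_min_inDegree hmin)
    (arc_of_mem ha) (arc_of_mem hb) (arc_of_mem hc)
end
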